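/- arXiv:math/0406601 — 2 statements merged into one kernel-verified Lean document; each statement's English description precedes it below -/
import Mathlib

section
/- Let E be a field of characteristic 0 and M a finite-dimensional E((t))-vector space equipped with a connection ∇_M : M → M extending the derivation f(t) ↦ t·df/dt of E((t)) (i.e. ∇_M is additive and ∇_M(f·m) = t(df/dt)·m + f·∇_M(m)). If ∇_M is trivial on M (there exists an E[[t]]-lattice M_0 of M with ∇_M(M_0) ⊂ t M_0) and N is a sub-E((t))-vector space of M stable under ∇_M, then ∇_M is trivial on N (there exists an E[[t]]-lattice N_0 of N with ∇_M(N_0) ⊂ t N_0). -/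
noncomputable section

/-- The derivation `f(t) ↦ t·df/dt` on the field of Laurent series `E((t))`. -/
def tDeriv (E : Type) [Field E] (f : LaurentSeries E) : LaurentSeries E :=
  ⟨fun n : ℤ => n • f.coeff n,
   f.isPWO_support'.mono (by
     intro n hn
     simp only [Function.mem_support] at hn ⊢
     intro h
     exact hn (by rw [h, smul_zero]))⟩

/-- The variable `t` of `E((t))`. -/
def tVar (E : Type) [Field E] : LaurentSeries E := HahnSeries.single (1 : ℤ) (1 : E)

/-- An `E[[t]]`-lattice of the sub-`E((t))`-vector space `W` of `M`: a finitely
generated `E[[t]]`-submodule spanning `W` over `E((t))`, i.e. the `E[[t]]`-span of an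
`E((t))`-basis of `W`. -/
def IsLatticeOf (E : Type) [Field E] {M : Type} [AddCommGroup M]
    [Module (LaurentSeries E) M] (W : Submodule (LaurentSeries E) M) (L : Set M) : Prop :=
  ∃ (d : ℕ) (e : Fin d → M), (∀ i, e i ∈ W) ∧
    Submodule.span (LaurentSeries E) (Set.range e) = W ∧
    LinearIndependent (LaurentSeries E) e ∧
    L = { x | ∃ c : Fin d → PowerSeries E, x = ∑ i, ((c i : LaurentSeries E) • e i) }

/-- Every vector of the `K`-span of an `R`-submodule `L` has a nonzero `R`-multiple in `L`. -/
theorem exists_ne_zero_smul_mem_of_mem_span {R K M : Type*} [CommRing R] [IsDomain R]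
    [Field K] [Algebra R K] [IsFractionRing R K] [AddCommGroup M] [Module K M] [Module R M]
    [IsScalarTower R K M] (L : Submodule R M) {x : M}
    (hx : x ∈ Submodule.span K (L : Set M)) : ∃ r : R, r ≠ 0 ∧ r • x ∈ L := by
  induction hx using Submodule.span_induction with
  | mem x hx => exact ⟨1, one_ne_zero, by simpa using hx⟩
  | zero => exact ⟨1, one_ne_zero, by simp⟩
  | add x y _ _ hx hy =>
    obtain ⟨r, hr, hrx⟩ := hx
    obtain ⟨s, hs, hsy⟩ := hy
    refine ⟨r * s, mul_ne_zero hr hs, ?_⟩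
    rw [smul_add]
    refine L.add_mem ?_ ?_
    · rw [mul_comm, mul_smul]
      exact L.smul_mem s hrx
    · rw [mul_smul]
      exact L.smul_mem r hsy
  | smul k x _ hx =>
    obtain ⟨r, hr, hrx⟩ := hx
    obtain ⟨a, b, hb, rfl⟩ := IsFractionRing.div_surjective (A := R) k
    have hb0 : algebraMap R K b ≠ 0 :=
      IsFractionRing.to_map_ne_zero_of_mem_nonZeroDivisors hb
    refine ⟨b * r, mul_ne_zero (nonZeroDivisors.ne_zero hb) hr, ?_⟩
    have h : (b * r) • (algebraMap R K a / algebraMap R K b) • x = a • r • x := by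
      rw [← algebraMap_smul K (b * r), ← algebraMap_smul K a, ← algebraMap_smul K r,
        smul_smul, smul_smul, map_mul]
      congr 1
      field_simp
    rw [h]
    exact L.smul_mem a hrx

/-- Over a principal ideal domain, the intersection of a lattice with a subspace has a basis
which is also a basis of the subspace over the fraction field. -/
theorem exists_linearIndependent_span_eq_inf_restrictScalars {R K M : Type*} [CommRing R]
    [IsDomain R] [IsPrincipalIdealRing R] [Field K] [Algebra R K] [IsFractionRing R K]
    [AddCommGroup M] [Module K M] [Module R M] [IsScalarTower R K M]
    (L : Submodule R M) (hL : L.FG) (hspan : Submodule.span K (L : Set M) = ⊤)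
    (N : Submodule K M) :
    ∃ (d : ℕ) (b : Fin d → M), LinearIndependent K b ∧
      Submodule.span K (Set.range b) = N ∧
      Submodule.span R (Set.range b) = L ⊓ N.restrictScalars R := by
  set P : Submodule R M := L ⊓ N.restrictScalars R
  have : Module.Finite R L := Module.Finite.iff_fg.mpr hL
  have : IsNoetherian R L := isNoetherian_of_isNoetherianRing_of_finite R L
  have : IsNoetherian R P := isNoetherian_of_le (inf_le_left : P ≤ L)
  have : Module.IsTorsionFree R M := Module.IsTorsionFree.trans_faithfulSMul R K M
  let B := Module.finBasis R P
  let b : Fin (Module.finrank R P) → M := fun i => (B i : M)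
  have hbspan : Submodule.span R (Set.range b) = P := by
    have h := congrArg (Submodule.map P.subtype) B.span_eq
    rw [Submodule.map_span, ← Set.range_comp, Submodule.map_top, Submodule.range_subtype] at h
    exact h
  refine ⟨_, b, ?_, ?_, hbspan⟩
  · rw [← LinearIndependent.iff_fractionRing R K]
    exact B.linearIndependent.map' P.subtype P.ker_subtype
  · apply le_antisymm
    · rw [Submodule.span_le]
      rintro _ ⟨i, rfl⟩
      exact (B i).2.2
    · intro x hx
      obtain ⟨r, hr, hrx⟩ := exists_ne_zero_smul_mem_of_mem_span (K := K) L
        (x := x) (hspan ▸ Submodule.mem_top)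
      have hrN : r • x ∈ N := by
        rw [← algebraMap_smul K]
        exact N.smul_mem _ hx
      have hmem : r • x ∈ Submodule.span R (Set.range b) := by
        rw [hbspan]
        exact ⟨hrx, hrN⟩
      have hK := Submodule.span_le_restrictScalars R K (Set.range b) hmem
      rw [Submodule.restrictScalars_mem, ← algebraMap_smul K] at hK
      exact ((Submodule.span K (Set.range b)).smul_mem_iff
        ((map_ne_zero_iff _ (IsFractionRing.injective R K)).mpr hr)).mp hK

/-- The set of `E[[t]]`-linear combinations in `IsLatticeOf` is an `E[[t]]`-span. -/
theorem setOf_eq_sum_coe_smul_eq_span (E : Type) [Field E] {M : Type} [AddCommGroup M]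
    [Module (LaurentSeries E) M] [Module (PowerSeries E) M]
    [IsScalarTower (PowerSeries E) (LaurentSeries E) M] {d : ℕ} (e : Fin d → M) :
    { x | ∃ c : Fin d → PowerSeries E, x = ∑ i, ((c i : LaurentSeries E) • e i) } =
      (Submodule.span (PowerSeries E) (Set.range e) : Set M) := by
  ext x
  simp only [Set.mem_ofPred_eq, SetLike.mem_coe, Submodule.mem_span_range_iff_exists_fun,
    ← LaurentSeries.coe_algebraMap, algebraMap_smul, eq_comm]

/-- Lemme 3.3 of [Berger]: let `E` be a field of characteristic `0` and `M` a
finite-dimensional `E((t))`-vector space equipped with a connection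
`∇_M : M → M` extending the derivation `f(t) ↦ t·df/dt` of `E((t))`. If `∇_M` is
trivial on `M` (there is an `E[[t]]`-lattice `M₀` of `M` with `∇_M(M₀) ⊆ t·M₀`) and
`N` is a sub-`E((t))`-vector space of `M` stable under `∇_M`, then `∇_M` is trivial on
`N` (there is an `E[[t]]`-lattice `N₀` of `N` with `∇_M(N₀) ⊆ t·N₀`). -/
theorem trivial_connection_on_subspace
    (E : Type) [Field E] [CharZero E]
    (M : Type) [AddCommGroup M] [Module (LaurentSeries E) M]
    [FiniteDimensional (LaurentSeries E) M]
    (nab : M →+ M)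
    (hleibniz : ∀ (f : LaurentSeries E) (m : M),
      nab (f • m) = tDeriv E f • m + f • nab m)
    (M0 : Set M) (hM0 : IsLatticeOf E (⊤ : Submodule (LaurentSeries E) M) M0)
    (hM0nab : ∀ m ∈ M0, ∃ y ∈ M0, nab m = tVar E • y)
    (N : Submodule (LaurentSeries E) M) (hN : ∀ m ∈ N, nab m ∈ N) :
    ∃ N0 : Set M, IsLatticeOf E N N0 ∧ ∀ m ∈ N0, ∃ y ∈ N0, nab m = tVar E • y := by
  let _ : Module (PowerSeries E) M :=
    Module.compHom M (algebraMap (PowerSeries E) (LaurentSeries E))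
  have : IsScalarTower (PowerSeries E) (LaurentSeries E) M :=
    IsScalarTower.of_algebraMap_smul fun _ _ => rfl
  obtain ⟨d, e, -, hspan, -, rfl⟩ := hM0
  rw [setOf_eq_sum_coe_smul_eq_span] at hM0nab
  set L := Submodule.span (PowerSeries E) (Set.range e)
  have hL : Submodule.span (LaurentSeries E) (L : Set M) = ⊤ :=
    top_le_iff.mp (hspan ▸ Submodule.span_mono Submodule.subset_span)
  obtain ⟨n, b, hli, hbN, hbL⟩ := exists_linearIndependent_span_eq_inf_restrictScalars L
    (Submodule.fg_span (Set.finite_range e)) hL N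
  refine ⟨(L : Set M) ∩ N, ⟨n, b, fun i => ?_, hbN, hli, ?_⟩, ?_⟩
  · exact hbN ▸ Submodule.subset_span (Set.mem_range_self i)
  · rw [setOf_eq_sum_coe_smul_eq_span, hbL]
    rfl
  · rintro m ⟨hmL, hmN⟩
    obtain ⟨y, hyL, hy⟩ := hM0nab m hmL
    have ht : tVar E ≠ 0 := HahnSeries.single_ne_zero one_ne_zero
    exact ⟨y, ⟨hyL, (N.smul_mem_iff ht).mp (hy ▸ hN m hmN)⟩, hy⟩
end
end

section
/- Let p be a prime, e ≥ 1 an integer, s ≥ 0 a real number, n_0 ≥ 1 an integer, and (b_i)_{i≥1} a sequence of real numbers. Then the sequence (b_i + s·log(i)/log(p))_{i≥1} is bounded below if and only if the double family (n·s + b_i + i/(e·p^{n-1}(p−1)))_{i≥1, n≥n_0} is bounded below. -/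
/-- A nonnegative multiple of the logarithm is dominated by the identity up to a constant. -/
theorem mul_log_le_add_const {a t : ℝ} (ha : 0 ≤ a) (ht : 0 < t) :
    a * Real.log t ≤ t + a * Real.log (a + 1) := by
  have hc : 0 < a + 1 := by linarith
  have h : Real.log t ≤ t / (a + 1) + Real.log (a + 1) := by
    have := Real.log_le_sub_one_of_pos (div_pos ht hc)
    rw [Real.log_div ht.ne' hc.ne'] at this
    linarith
  have h' : a * (t / (a + 1)) ≤ t := by
    rw [← mul_div_assoc, div_le_iff₀ hc]
    nlinarith
  nlinarith [mul_le_mul_of_nonneg_left h ha]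

/-- The logarithm of `i` in terms of that of its quotient by `e * p ^ (n - 1) * (p - 1)`. -/
theorem log_le_log_div_add {p e i : ℝ} (hp : 1 < p) (he : 0 < e) (hi : 0 < i)
    {n : ℕ} (hn : 1 ≤ n) :
    Real.log i ≤ Real.log (i / (e * p ^ (n - 1) * (p - 1))) + Real.log e + n * Real.log p := by
  have hp1 : 0 < p - 1 := by linarith
  have hpow : 0 < p ^ (n - 1) := by positivity
  rw [Real.log_div hi.ne' (by positivity), Real.log_mul (by positivity) hp1.ne',
    Real.log_mul he.ne' hpow.ne', Real.log_pow, Nat.cast_sub hn]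
  have := Real.log_le_log hp1 (sub_le_self p zero_le_one)
  push_cast
  linarith

/-- For `n > Nat.log p i` the quotient of `i` by `e * p ^ (n - 1) * (p - 1)` is at most `p`. -/
theorem div_mul_pow_mul_le {p e i n : ℕ} (hp : 1 < p) (he : 1 ≤ e) (hn : Nat.log p i < n) :
    (i : ℝ) / (e * p ^ (n - 1) * (p - 1)) ≤ p := by
  have hp2 : (2 : ℝ) ≤ p := by exact_mod_cast hp
  have he' : (1 : ℝ) ≤ e := by exact_mod_cast he
  have hpow : (0 : ℝ) < p ^ (n - 1) := by positivity
  have hi : (i : ℝ) ≤ p ^ (n - 1) * p := by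
    rw [← pow_succ, Nat.sub_add_cancel (by omega)]
    exact_mod_cast (Nat.lt_pow_of_log_lt hp hn).le
  have hD : (p : ℝ) ^ (n - 1) ≤ e * p ^ (n - 1) * (p - 1) := by
    have h1 : (p : ℝ) ^ (n - 1) ≤ e * p ^ (n - 1) := le_mul_of_one_le_left hpow.le he'
    exact h1.trans (le_mul_of_one_le_right (hpow.le.trans h1) (by linarith))
  rw [div_le_iff₀ (hpow.trans_le hD), mul_comm]
  exact hi.trans (mul_le_mul_of_nonneg_right hD (by positivity))

/-- Proposition 5.3 (4) of [Berger], the underlying real-analysis exercise: let `p` be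
a prime, `e ≥ 1` an integer, `s ≥ 0` a real number, `n₀ ≥ 1` an integer and `(b_i)`
a sequence of real numbers. Then the sequence `(b_i + s·log(i)/log(p))_{i ≥ 1}` is
bounded below if and only if the double family
`(n·s + b_i + i/(e·p^{n-1}(p-1)))_{i ≥ 1, n ≥ n₀}` is bounded below. -/
theorem order_bounded_below_iff
    (p : ℕ) (hp : p.Prime) (e : ℕ) (he : 1 ≤ e) (s : ℝ) (hs : 0 ≤ s)
    (n0 : ℕ) (hn0 : 1 ≤ n0) (b : ℕ → ℝ) :
    (∃ C : ℝ, ∀ i : ℕ, 1 ≤ i → C ≤ b i + s * Real.log i / Real.log p) ↔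
    (∃ C : ℝ, ∀ i : ℕ, 1 ≤ i → ∀ n : ℕ, n0 ≤ n →
      C ≤ n * s + b i + i / (e * p ^ (n - 1) * (p - 1))) := by
  have hp1 : (1 : ℝ) < p := by exact_mod_cast hp.one_lt
  have hL : 0 < Real.log p := Real.log_pos hp1
  constructor
  · rintro ⟨C, hC⟩
    set a := s / Real.log p with ha_def
    have ha : 0 ≤ a := div_nonneg hs hL.le
    refine ⟨C - a * Real.log e - a * Real.log (a + 1), fun i hi n hn => ?_⟩
    have he0 : (0 : ℝ) < e := by exact_mod_cast he
    have hi0 : (0 : ℝ) < i := by exact_mod_cast hi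
    have hpp : (0 : ℝ) < p - 1 := by linarith
    have ht : 0 < (i : ℝ) / (e * p ^ (n - 1) * (p - 1)) := by positivity
    have h1 := mul_log_le_add_const ha ht
    have h2 := mul_le_mul_of_nonneg_left
      (log_le_log_div_add hp1 he0 hi0 (hn0.trans hn)) ha
    have h3 : a * (n * Real.log p) = n * s := by
      rw [ha_def]
      field_simp
    have h4 : s * Real.log i / Real.log p = a * Real.log i := by
      rw [ha_def]
      ring
    have h5 := hC i hi
    rw [h4] at h5
    rw [mul_add, mul_add, h3] at h2
    linarith
  · rintro ⟨C, hC⟩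
    refine ⟨C - n0 * s - p, fun i hi => ?_⟩
    have h1 := hC i hi (n0 + Nat.log p i) (Nat.le_add_right _ _)
    have h2 := div_mul_pow_mul_le (i := i) (n := n0 + Nat.log p i) hp.one_lt he (by omega)
    have h3 : (Nat.log p i : ℝ) * s ≤ s * Real.log i / Real.log p := by
      rw [mul_comm, mul_div_assoc]
      exact mul_le_mul_of_nonneg_left (Real.natLog_le_logb i p) hs
    rw [Nat.cast_add, add_mul] at h1
    linarith
end
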